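/- arXiv:1407.5298 — 2 statements merged into one kernel-verified Lean document; each statement's English description precedes it below -/
import Mathlib

section
/- Let L be a packing LP: maximize ⟨π, x⟩ over x ∈ [0,1]^n subject to Ax ≤ b, with π ∈ ℝ_{≥0}^n, all entries of A in [0,1], and b ∈ ℝ_{>0}^m. Then for every τ ≥ OPT(L)/(min_i b_i), one has OPT(skim_τ(L)) + Σ_{t : π_t > τ} π_t = OPT(L). -/
open Finset
open scoped Classical

noncomputable section

/-- A packing LP `max ⟨π,x⟩ s.t. Ax ≤ b, x ∈ [0,1]^ι`, with columns indexed by `ι` and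
`m` packing constraints. -/
structure PLP (ι : Type) (m : ℕ) where
  pi : ι → ℝ
  A : ι → Fin m → ℝ
  b : Fin m → ℝ

namespace PLP

variable {ι : Type} [Fintype ι] {m : ℕ}

/-- `π ≥ 0`, all entries of `A` in `[0,1]`, `b > 0`. -/
def NonnegData (L : PLP ι m) : Prop :=
  (∀ t, 0 ≤ L.pi t) ∧ (∀ t i, L.A t i ∈ Set.Icc (0 : ℝ) 1) ∧ (∀ i, 0 < L.b i)

/-- feasibility for a packing LP. -/
def Feasible (L : PLP ι m) (x : ι → ℝ) : Prop :=
  (∀ t, x t ∈ Set.Icc (0 : ℝ) 1) ∧ ∀ i, ∑ t, L.A t i * x t ≤ L.b i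

/-- value of a solution. -/
def value (L : PLP ι m) (x : ι → ℝ) : ℝ := ∑ t, L.pi t * x t

/-- optimal value of a packing LP (`0 = sSup ∅` if infeasible). -/
def opt (L : PLP ι m) : ℝ := sSup {v : ℝ | ∃ x, L.Feasible x ∧ v = L.value x}

/-- the skimmed LP `skim_τ(L)`: the values of the high-value items `H = {t : π_t > τ}`
are set to zero, and the right-hand side becomes `b - Σ_{t∈H} A^t`. -/
def skim (L : PLP ι m) (τ : ℝ) : PLP ι m where
  pi := fun t => if τ < L.pi t then 0 else L.pi t
  A := L.A
  b := fun i => L.b i - ∑ t ∈ Finset.univ.filter (fun t => τ < L.pi t), L.A t i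

/-- `L_{<K}` style operation: set to zero the values of the items in `T`. -/
def zeroOn (L : PLP ι m) (T : Finset ι) : PLP ι m :=
  { L with pi := fun t => if t ∈ T then 0 else L.pi t }

/-- the restricted LP `L^I`: only the columns in `I` are kept and the right-hand side
is scaled by `|I| / |ι|`. -/
def restrict (L : PLP ι m) (I : Finset ι) : PLP {t // t ∈ I} m where
  pi := fun t => L.pi t
  A := fun t => L.A t
  b := fun i => ((I.card : ℝ) / (Fintype.card ι)) * L.b i

end PLP

/-- `τ` is a `Δ`-good skimming threshold for `L` (with parameters `ε` and `B`). -/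
def GoodSkim {ι : Type} [Fintype ι] {m : ℕ} (L : PLP ι m) (ε B τ Δ : ℝ) : Prop :=
  ((1 - ε) * L.opt ≤
      (L.skim τ).opt + ∑ t ∈ Finset.univ.filter (fun t => τ < L.pi t), L.pi t) ∧
  (∀ i, L.b i / 2 ≤ (L.skim τ).b i) ∧
  τ ≤ 24 * Δ / B

/-- fraction of the `binomial(|ι|,s)` subsets of size `s` satisfying `P`. -/
def subsetFrac (ι : Type) [Fintype ι] (s : ℕ) (P : Finset ι → Prop) : ℝ :=
  (Nat.card {I : Finset ι // I.card = s ∧ P I} : ℝ) /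
    (Nat.card {I : Finset ι // I.card = s} : ℝ)


theorem PLP.exists_opt {ι : Type} [Fintype ι] {m : ℕ} (L : PLP ι m) (hL : L.NonnegData) :
    ∃ x, L.Feasible x ∧ ∀ y, L.Feasible y → L.value y ≤ L.value x := by
  have hc : IsCompact {x : ι → ℝ | L.Feasible x} := by
    have h1 : IsCompact (Set.univ.pi (fun _ : ι => Set.Icc (0 : ℝ) 1)) :=
      isCompact_univ_pi (fun _ => isCompact_Icc)
    have h2 : IsClosed {x : ι → ℝ | ∀ i, ∑ t, L.A t i * x t ≤ L.b i} := by
      rw [Set.setOf_forall]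
      refine isClosed_iInter (fun i => isClosed_le ?_ continuous_const)
      fun_prop
    have h3 := h1.inter_right h2
    convert h3 using 1
    ext x
    simp only [PLP.Feasible, Set.mem_setOf_eq, Set.mem_inter_iff, Set.mem_univ_pi]
  have hne : {x : ι → ℝ | L.Feasible x}.Nonempty := by
    refine ⟨fun _ => 0, fun _ => by simp, fun i => ?_⟩
    simpa using (hL.2.2 i).le
  have hcont : ContinuousOn (fun x => L.value x) {x : ι → ℝ | L.Feasible x} := by
    unfold PLP.value
    fun_prop
  obtain ⟨x, hx, hmax⟩ := hc.exists_isMaxOn hne hcont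
  exact ⟨x, hx, fun y hy => hmax hy⟩

theorem PLP.opt_eq {ι : Type} [Fintype ι] {m : ℕ} (L : PLP ι m) (x : ι → ℝ)
    (hx : L.Feasible x) (h : ∀ y, L.Feasible y → L.value y ≤ L.value x) :
    L.opt = L.value x := by
  refine IsGreatest.csSup_eq ⟨⟨x, hx, rfl⟩, ?_⟩
  rintro v ⟨y, hy, rfl⟩
  exact h y hy

theorem PLP.key {ι : Type} [Fintype ι] {m : ℕ} (L : PLP ι m) (hL : L.NonnegData) (x : ι → ℝ)
    (hx : L.Feasible x) (h : ∀ y, L.Feasible y → L.value y ≤ L.value x) (B : ℝ) (hB : 0 < B)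
    (hBb : ∀ i, B ≤ L.b i) (k : ι) (hk : L.value x < B * L.pi k) : x k = 1 := by
  by_contra hne
  have hlt : x k < 1 := lt_of_le_of_ne (hx.1 k).2 hne
  have hx0 := (hx.1 k).1
  set e : ℝ := (1 - x k) / (1 + B) with he
  have he0 : 0 < e := by rw [he]; apply div_pos <;> linarith
  have hemul : e * (1 + B) = 1 - x k := by rw [he]; field_simp
  have heB : 0 < e * B := by positivity
  have he1 : e ≤ 1 := by nlinarith
  have hsum : ∀ c : ι → ℝ, ∑ t, c t * ((1 - e) * x t + if t = k then e * B else 0)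
      = (1 - e) * ∑ t, c t * x t + e * B * c k := by
    intro c
    simp only [mul_add, Finset.sum_add_distrib, mul_ite, mul_zero, Finset.sum_ite_eq',
      Finset.mem_univ, if_true, Finset.mul_sum]
    congr 1
    · exact Finset.sum_congr rfl (fun t _ => by ring)
    · simp [mul_comm]
  have := h (fun t => (1 - e) * x t + if t = k then e * B else 0) ⟨?_, ?_⟩
  · unfold PLP.value at this hk
    rw [hsum] at this
    nlinarith
  · intro t
    have h0 := (hx.1 t).1
    have h1 := (hx.1 t).2
    have h2 : 0 ≤ (1 - e) * x t := mul_nonneg (by linarith) h0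
    have h3 : 0 ≤ e * x t := mul_nonneg he0.le h0
    by_cases htk : t = k
    · subst htk
      simp only [if_true]
      constructor <;> nlinarith
    · simp only [htk, if_false]
      constructor <;> nlinarith
  · intro i
    rw [hsum (fun t => L.A t i)]
    have hA := hL.2.1 k i
    have h4 : e * B * L.A k i ≤ e * L.b i := by
      have : e * B * L.A k i ≤ e * B := mul_le_of_le_one_right heB.le hA.2
      have := mul_le_mul_of_nonneg_left (hBb i) he0.le
      linarith
    have := mul_le_mul_of_nonneg_left (hx.2 i) (by linarith : 0 ≤ 1 - e)
    linarith

/-- Perfect Threshold: for every `τ ≥ OPT(L)/min_i b_i`, picking all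
items of value `> τ` and solving the skimmed LP loses nothing:
`OPT(skim_τ(L)) + Σ_{t:π_t>τ} π_t = OPT(L)`. -/
theorem stmt14 {n m : ℕ} (hm : 1 ≤ m) (L : PLP (Fin n) m) (hL : L.NonnegData)
    (τ : ℝ) (hτ : L.opt / (⨅ i, L.b i) ≤ τ) :
    (L.skim τ).opt + ∑ t ∈ Finset.univ.filter (fun t => τ < L.pi t), L.pi t = L.opt := by
  obtain ⟨x, hx, hmax⟩ := L.exists_opt hL
  have hopt := L.opt_eq x hx hmax
  haveI : Nonempty (Fin m) := ⟨⟨0, hm⟩⟩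
  have hB : 0 < ⨅ i, L.b i := by
    obtain ⟨i, hi⟩ := exists_eq_ciInf_of_finite (f := L.b)
    rw [← hi]; exact hL.2.2 i
  have hBb : ∀ i, (⨅ i, L.b i) ≤ L.b i := fun i => ciInf_le (Set.finite_range _).bddBelow i
  have hone : ∀ k, τ < L.pi k → x k = 1 := by
    intro k hk
    refine L.key hL x hx hmax _ hB hBb k ?_
    rw [← hopt]
    have := (div_lt_iff₀ hB).1 (lt_of_le_of_lt hτ hk)
    linarith
  -- upper bound
  have hub : ∀ y, (L.skim τ).Feasible y → (L.skim τ).value y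
      + ∑ t ∈ Finset.univ.filter (fun t => τ < L.pi t), L.pi t ≤ L.value x := by
    intro y hy
    refine le_trans (le_of_eq ?_) (hmax (fun t => if τ < L.pi t then 1 else y t) ⟨?_, ?_⟩)
    · simp only [PLP.value, PLP.skim, Finset.sum_filter]
      rw [← Finset.sum_add_distrib]
      refine Finset.sum_congr rfl (fun t _ => ?_)
      split_ifs <;> simp
    · intro t
      dsimp only
      split_ifs
      · simp
      · exact hy.1 t
    · intro i
      have h1 := hy.2 i
      simp only [PLP.skim, Finset.sum_filter] at h1
      refine le_trans ?_ (le_sub_iff_add_le.1 h1)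
      rw [← Finset.sum_add_distrib]
      refine Finset.sum_le_sum (fun t _ => ?_)
      have := mul_nonneg (hL.2.1 t i).1 (hy.1 t).1
      dsimp only
      split_ifs
      · linarith
      · linarith
  have hf : (L.skim τ).Feasible (fun t => if τ < L.pi t then 0 else x t) := by
    refine ⟨fun t => ?_, fun i => ?_⟩
    · dsimp only
      split_ifs
      · simp
      · exact hx.1 t
    · simp only [PLP.skim, Finset.sum_filter]
      rw [le_sub_iff_add_le, ← Finset.sum_add_distrib]
      refine le_trans (le_of_eq (Finset.sum_congr rfl (fun t _ => ?_))) (hx.2 i)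
      split_ifs with h
      · simp [hone t h]
      · simp
  have hv : (L.skim τ).value (fun t => if τ < L.pi t then 0 else x t)
      + ∑ t ∈ Finset.univ.filter (fun t => τ < L.pi t), L.pi t = L.value x := by
    simp only [PLP.value, PLP.skim, Finset.sum_filter]
    rw [← Finset.sum_add_distrib]
    refine Finset.sum_congr rfl (fun t _ => ?_)
    split_ifs with h
    · simp [hone t h]
    · simp
  rw [(L.skim τ).opt_eq _ hf (fun y hy => by have := hub y hy; linarith), hv, hopt]

end
end

section
/- Let ε ∈ (0, 1/3], let B > 0, and let L be a feasible packing LP with width at least B (all entries of A in [0,1] and b_i ≥ B for all i). Let K be a positive integer that is at most ε/2 times the width of L, and let L_{<K} be obtained from L by setting to zero the values π_t of the K largest-valued items (right-hand side unchanged). Then every τ satisfying τ ≥ 3·OPT(L_{<K})/B satisfies: (S1) OPT(skim_τ(L)) + Σ_{t : π_t > τ} π_t ≥ (1 − ε)·OPT(L), and (S2) RHS(skim_τ(L)) ≥ (1/2)·RHS(L) coordinatewise (in particular, τ is a (τB/24)-good skimming threshold for L). -/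
open Finset
open scoped Classical

noncomputable section

theorem PLP.opt_ge {ι : Type} [Fintype ι] {m : ℕ} (L : PLP ι m) (hpi : ∀ t, 0 ≤ L.pi t)
    (x : ι → ℝ) (hx : L.Feasible x) : L.value x ≤ L.opt := by
  refine le_csSup ⟨∑ t, L.pi t, ?_⟩ ⟨x, hx, rfl⟩
  rintro v ⟨y, hy, rfl⟩
  refine Finset.sum_le_sum fun t _ => ?_
  have := (hy.1 t).2
  nlinarith [hpi t]

/-- any `τ ≥ 3·OPT(L_{<K})/B` is a `(τB/24)`-good skimming threshold
for `L`: it satisfies (S1) and (S2) (and trivially (S3)). -/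
theorem stmt15 {n m : ℕ} (L : PLP (Fin n) m) (hL : L.NonnegData)
    (hfeas : ∃ x, L.Feasible x)
    (ε B : ℝ) (hε0 : 0 < ε) (hε1 : ε ≤ 1 / 3) (hB : 0 < B)
    -- the width of `L` is at least `B`:
    (hwidth : ∀ i, B ≤ L.b i)
    -- `K` is a positive integer at most `ε/2` times the width of `L`:
    (K : ℕ) (hK1 : 1 ≤ K) (hKw : ∀ i, (K : ℝ) ≤ ε / 2 * L.b i)
    -- `T` is the set of the `K` largest-valued items, so that `L.zeroOn T = L_{<K}`:
    (T : Finset (Fin n)) (hTcard : T.card = K)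
    (hTtop : ∀ t ∈ T, ∀ s ∉ T, L.pi s ≤ L.pi t) :
    ∀ τ : ℝ, 3 * (L.zeroOn T).opt / B ≤ τ →
      -- (S1):
      ((1 - ε) * L.opt ≤
          (L.skim τ).opt + ∑ t ∈ Finset.univ.filter (fun t => τ < L.pi t), L.pi t) ∧
      -- (S2):
      (∀ i, L.b i / 2 ≤ (L.skim τ).b i) ∧
      -- in particular, `τ` is a `(τB/24)`-good skimming threshold for `L`:
      GoodSkim L ε B τ (τ * B / 24) := by
  intro τ hτ
  obtain ⟨hpi, hA, hb⟩ := hL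
  set O := (L.zeroOn T).opt with hO
  have hzpi : ∀ t, 0 ≤ (L.zeroOn T).pi t := by
    intro t
    simp only [PLP.zeroOn]
    split_ifs
    · exact le_rfl
    · exact hpi t
  have hOB : 3 * O ≤ τ * B := by rwa [div_le_iff₀ hB] at hτ
  set H : Finset (Fin n) := Finset.univ.filter (fun t => τ < L.pi t) with hH
  have memH : ∀ t, t ∈ H ↔ τ < L.pi t := by intro t; simp [hH]
  have hh : ((H \ T).card : ℝ) * 3 ≤ B := by
    by_contra hcon
    push Not at hcon
    have hpos : (0 : ℝ) < ((H \ T).card : ℝ) := by linarith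
    have hpos2 : 0 < (H \ T).card := by exact_mod_cast hpos
    set h : ℝ := ((H \ T).card : ℝ) with hhdef
    have hne : (H \ T).Nonempty := by
      rw [← Finset.card_pos]; exact hpos2
    set c : ℝ := B / (3 * h) with hc
    have hc0 : 0 < c := by positivity
    have hch : c * h = B / 3 := by rw [hc]; field_simp
    have hc1 : c ≤ 1 := by rw [hc, div_le_one (by positivity)]; linarith
    have hf : (L.zeroOn T).Feasible (fun t => if t ∈ H \ T then c else 0) := by
      refine ⟨fun t => ?_, fun i => ?_⟩
      · dsimp only
        split_ifs
        · exact ⟨hc0.le, hc1⟩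
        · exact ⟨le_rfl, zero_le_one⟩
      · have : ∑ t, (L.zeroOn T).A t i * (if t ∈ H \ T then c else 0)
            = ∑ t ∈ H \ T, L.A t i * c := by
          simp only [mul_ite, mul_zero, Finset.sum_ite_mem, Finset.univ_inter]
          rfl
        rw [this]
        have h2 : ∑ t ∈ H \ T, L.A t i * c ≤ ∑ t ∈ H \ T, c :=
          Finset.sum_le_sum fun t _ => by nlinarith [(hA t i).2]
        rw [Finset.sum_const, nsmul_eq_mul] at h2
        have h3 : (L.zeroOn T).b i = L.b i := rfl
        rw [h3]
        have := hwidth i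
        nlinarith
    have h1 := PLP.opt_ge _ hzpi _ hf
    have h2 : (L.zeroOn T).value (fun t => if t ∈ H \ T then c else 0)
        = ∑ t ∈ H \ T, L.pi t * c := by
      simp only [PLP.value, mul_ite, mul_zero, Finset.sum_ite_mem, Finset.univ_inter]
      refine Finset.sum_congr rfl fun t ht => ?_
      simp [PLP.zeroOn, (Finset.mem_sdiff.1 ht).2]
    rw [h2] at h1
    have h3 : ∑ t ∈ H \ T, τ * c < ∑ t ∈ H \ T, L.pi t * c :=
      Finset.sum_lt_sum_of_nonempty hne fun t ht =>
        mul_lt_mul_of_pos_right ((memH t).1 (Finset.mem_sdiff.1 ht).1) hc0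
    rw [Finset.sum_const, nsmul_eq_mul] at h3
    have h4 : h * (τ * c) = τ * B / 3 := by
      rw [show h * (τ * c) = τ * (c * h) by ring, hch]; ring
    rw [← hhdef] at h3
    linarith
  have hHT : ((H ∩ T).card : ℝ) ≤ K := by
    rw [← hTcard]; exact_mod_cast Finset.card_le_card Finset.inter_subset_right
  have hsplit : ∀ f : Fin n → ℝ, ∑ t ∈ H, f t = ∑ t ∈ H ∩ T, f t + ∑ t ∈ H \ T, f t :=
    fun f => (Finset.sum_inter_add_sum_sdiff H T f).symm
  have ha : ∀ i, ∑ t ∈ H, L.A t i ≤ L.b i / 2 := by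
    intro i
    have h1 : ∑ t ∈ H ∩ T, L.A t i ≤ ∑ t ∈ H ∩ T, (1:ℝ) :=
      Finset.sum_le_sum fun t _ => (hA t i).2
    have h2 : ∑ t ∈ H \ T, L.A t i ≤ ∑ t ∈ H \ T, (1:ℝ) :=
      Finset.sum_le_sum fun t _ => (hA t i).2
    rw [Finset.sum_const, nsmul_eq_mul, mul_one] at h1 h2
    rw [hsplit]
    have := hwidth i
    have := hKw i
    have := hb i
    nlinarith
  have S2 : ∀ i, L.b i / 2 ≤ (L.skim τ).b i := by
    intro i
    have h1 : (L.skim τ).b i = L.b i - ∑ t ∈ H, L.A t i := rfl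
    rw [h1]
    linarith [ha i]
  have hskpi : ∀ t, 0 ≤ (L.skim τ).pi t := by
    intro t
    simp only [PLP.skim]
    split_ifs
    · exact le_rfl
    · exact hpi t
  have key : ∀ x, L.Feasible x →
      (1 - ε) * L.value x ≤ (L.skim τ).opt + ∑ t ∈ H, L.pi t := by
    intro x hx
    set g : ℝ := ∑ t ∈ H \ T, (1 - x t) with hg
    have hg0 : 0 ≤ g := Finset.sum_nonneg fun t _ => by linarith [(hx.1 t).2]
    have hgh : g ≤ ((H \ T).card : ℝ) := by
      have : g ≤ ∑ t ∈ H \ T, (1:ℝ) :=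
        Finset.sum_le_sum fun t _ => by linarith [(hx.1 t).1]
      rwa [Finset.sum_const, nsmul_eq_mul, mul_one] at this
    set q : ℝ := g / B with hq
    have hqB : q * B = g := by rw [hq]; field_simp
    have hq0 : 0 ≤ q := by positivity
    have hq3 : q ≤ 1 / 3 := by rw [hq, div_le_iff₀ hB]; linarith
    set l : ℝ := 2 * q + ε with hl
    have hl0 : 0 ≤ l := by positivity
    have hl1 : l ≤ 1 := by linarith
    have hcompl : ∀ f : Fin n → ℝ, ∑ t, f t = ∑ t ∈ H, f t + ∑ t ∈ Hᶜ, f t :=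
      fun f => (Finset.sum_add_sum_compl H f).symm
    set V : ℝ := ∑ t ∈ Hᶜ, L.pi t * x t with hV
    have hV0 : 0 ≤ V := Finset.sum_nonneg fun t _ => mul_nonneg (hpi t) (hx.1 t).1
    have hgV : q * V ≤ q * O := by
      by_cases hsub : H ⊆ T
      · have : g = 0 := by rw [hg, Finset.sdiff_eq_empty_iff_subset.2 hsub]; simp
        have : q = 0 := by rw [hq, this]; simp
        simp [this]
      · obtain ⟨s, hs, hsT⟩ := Finset.not_subset.1 hsub
        have hTH : T ⊆ H := fun t ht =>
          (memH t).2 (lt_of_lt_of_le ((memH s).1 hs) (hTtop t ht s hsT))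
        refine mul_le_mul_of_nonneg_left ?_ hq0
        have h1 := PLP.opt_ge (L.zeroOn T) hzpi x hx
        refine le_trans ?_ h1
        rw [PLP.value, hcompl]
        have h2 : 0 ≤ ∑ t ∈ H, (L.zeroOn T).pi t * x t :=
          Finset.sum_nonneg fun t _ => mul_nonneg (hzpi t) (hx.1 t).1
        have h3 : V = ∑ t ∈ Hᶜ, (L.zeroOn T).pi t * x t := by
          refine Finset.sum_congr rfl fun t ht => ?_
          have : t ∉ T := fun h => (Finset.mem_compl.1 ht) (hTH h)
          simp [PLP.zeroOn, this]
        linarith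
    have hf : (L.skim τ).Feasible (fun t => if t ∈ Hᶜ then (1 - l) * x t else 0) := by
      refine ⟨fun t => ?_, fun i => ?_⟩
      · dsimp only
        have h0 := (hx.1 t).1
        have h1 := (hx.1 t).2
        split_ifs
        · exact ⟨mul_nonneg (by linarith) h0, by nlinarith⟩
        · exact ⟨le_rfl, zero_le_one⟩
      · have h1 : ∑ t, (L.skim τ).A t i * (if t ∈ Hᶜ then (1 - l) * x t else 0)
            = (1 - l) * ∑ t ∈ Hᶜ, L.A t i * x t := by
          simp only [mul_ite, mul_zero, Finset.sum_ite_mem, Finset.univ_inter, Finset.mul_sum]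
          refine Finset.sum_congr rfl fun t _ => ?_
          simp only [PLP.skim]
          ring
        rw [h1]
        have h2 : (L.skim τ).b i = L.b i - ∑ t ∈ H, L.A t i := rfl
        rw [h2]
        have h3 := hx.2 i
        rw [hcompl] at h3
        set U := ∑ t ∈ Hᶜ, L.A t i * x t
        set u := ∑ t ∈ H, L.A t i * x t with hu
        have h4 : ∑ t ∈ H, L.A t i - u ≤ g + K := by
          rw [hu, ← Finset.sum_sub_distrib, hsplit]
          have e1 : ∑ t ∈ H ∩ T, (L.A t i - L.A t i * x t) ≤ ∑ t ∈ H ∩ T, (1:ℝ) :=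
            Finset.sum_le_sum fun t _ => by
              nlinarith [(hA t i).2, (hA t i).1, mul_nonneg (hA t i).1 (hx.1 t).1]
          have e2 : ∑ t ∈ H \ T, (L.A t i - L.A t i * x t) ≤ g :=
            Finset.sum_le_sum fun t _ => by nlinarith [(hA t i).2, (hx.1 t).2]
          rw [Finset.sum_const, nsmul_eq_mul, mul_one] at e1
          linarith
        have h5 : u ≤ L.b i / 2 := by
          refine le_trans ?_ (ha i)
          exact Finset.sum_le_sum fun t _ => by nlinarith [(hA t i).1, (hx.1 t).2]
        have h6 : (1 - l) * U ≤ (1 - l) * (L.b i - u) :=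
          mul_le_mul_of_nonneg_left (by linarith) (by linarith)
        have h7 : l * (L.b i / 2) ≤ l * (L.b i - u) :=
          mul_le_mul_of_nonneg_left (by linarith) hl0
        have h8 : q * B ≤ q * L.b i := mul_le_mul_of_nonneg_left (hwidth i) hq0
        have h9 := hKw i
        have h10 : l * (L.b i / 2) = q * L.b i + ε / 2 * L.b i := by rw [hl]; ring
        nlinarith
    have h1 := PLP.opt_ge _ hskpi _ hf
    have h2 : (L.skim τ).value (fun t => if t ∈ Hᶜ then (1 - l) * x t else 0)
        = (1 - l) * V := by
      simp only [PLP.value, mul_ite, mul_zero, Finset.sum_ite_mem, Finset.univ_inter,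
        hV, Finset.mul_sum]
      refine Finset.sum_congr rfl fun t ht => ?_
      have : ¬ τ < L.pi t := fun h => (Finset.mem_compl.1 ht) ((memH t).2 h)
      simp only [PLP.skim, if_neg this]
      ring
    rw [h2] at h1
    have h3 : g * τ ≤ ∑ t ∈ H, L.pi t - ∑ t ∈ H, L.pi t * x t := by
      rw [← Finset.sum_sub_distrib, hsplit, hg, Finset.sum_mul]
      have e1 : 0 ≤ ∑ t ∈ H ∩ T, (L.pi t - L.pi t * x t) :=
        Finset.sum_nonneg fun t _ => by nlinarith [hpi t, (hx.1 t).2]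
      have e2 : ∑ t ∈ H \ T, (1 - x t) * τ ≤ ∑ t ∈ H \ T, (L.pi t - L.pi t * x t) :=
        Finset.sum_le_sum fun t ht => by
          have := (memH t).1 (Finset.mem_sdiff.1 ht).1
          nlinarith [(hx.1 t).2]
      linarith
    have h4 : L.value x = ∑ t ∈ H, L.pi t * x t + V := hcompl _
    have h5 : 0 ≤ ∑ t ∈ H, L.pi t * x t :=
      Finset.sum_nonneg fun t _ => mul_nonneg (hpi t) (hx.1 t).1
    have h6 : q * (3 * O) ≤ q * (τ * B) := mul_le_mul_of_nonneg_left hOB hq0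
    have h7 : q * (τ * B) = g * τ := by rw [← hqB]; ring
    have h8 : (1 - l) * V = V - 2 * (q * V) - ε * V := by rw [hl]; ring
    have h9 : 0 ≤ q * V := mul_nonneg hq0 hV0
    have h10 : 0 ≤ ε * ∑ t ∈ H, L.pi t * x t := mul_nonneg hε0.le h5
    rw [h4]
    linarith
  have S1 : (1 - ε) * L.opt ≤ (L.skim τ).opt + ∑ t ∈ H, L.pi t := by
    have h1 : 0 < 1 - ε := by linarith
    rw [mul_comm, ← le_div_iff₀ h1]
    obtain ⟨x0, hx0⟩ := hfeas
    refine csSup_le ⟨_, x0, hx0, rfl⟩ ?_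
    rintro v ⟨x, hx, rfl⟩
    rw [le_div_iff₀ h1, mul_comm]
    exact key x hx
  refine ⟨S1, S2, S1, S2, ?_⟩
  rw [le_div_iff₀ hB]
  linarith

end
end
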